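/- For all message vectors m, m′ ∈ B with m ≠ m′, the map q satisfies ‖q(m) − q(m′)‖₂ / ‖m − m′‖₂ ≤ 2 · max_{(u→v)∈E⃗} Φ(u,v) · max_{(w→u)∈E⃗} Φ′(w,u). -/

import Mathlib

open Finset MeasureTheory Filter

noncomputable def l2norm {ι : Type*} [Fintype ι] (x : ι → ℝ) : ℝ :=
  Real.sqrt (∑ i, x i ^ 2)

structure GM (V : Type*) [Fintype V] [DecidableEq V] where
  G : SimpleGraph V
  adjDec : DecidableRel G.Adj
  d : ℕ
  ψn : V → Fin d → ℝ
  ψe : V → V → Fin d → Fin d → ℝ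

attribute [instance] GM.adjDec

namespace GM

variable {V : Type*} [Fintype V] [DecidableEq V] (P : GM V)

abbrev DirEdge : Type _ := {e : V × V // P.G.Adj e.1 e.2}

abbrev Msg : Type _ := P.DirEdge × Fin P.d → ℝ

noncomputable def bmass (e : P.DirEdge) (j : Fin P.d) : ℝ :=
  P.ψn e.1.1 j * ∑ i, P.ψe e.1.1 e.1.2 i j

noncomputable def Gam (e : P.DirEdge) (i j : Fin P.d) : ℝ :=
  P.ψe e.1.1 e.1.2 i j * P.ψn e.1.1 j / P.bmass e j

def revEdge (e : P.DirEdge) (w : {x // x ∈ (P.G.neighborFinset e.1.1).erase e.1.2}) :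
    P.DirEdge :=
  ⟨(w.1, e.1.1), by
    have h := Finset.mem_of_mem_erase w.2
    rw [SimpleGraph.mem_neighborFinset] at h
    exact h.symm⟩

noncomputable def Mprod (m : P.Msg) (e : P.DirEdge) (j : Fin P.d) : ℝ :=
  ∏ w ∈ ((P.G.neighborFinset e.1.1).erase e.1.2).attach, m (P.revEdge e w, j)

noncomputable def bp (m : P.Msg) : P.Msg := fun p =>
  (∑ j, P.ψe p.1.1.1 p.1.1.2 p.2 j * P.ψn p.1.1.1 j * P.Mprod m p.1 j) /
  (∑ i, ∑ j, P.ψe p.1.1.1 p.1.1.2 i j * P.ψn p.1.1.1 j * P.Mprod m p.1 j)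

noncomputable def beta0 (e : P.DirEdge) (i : Fin P.d) : ℝ := ⨅ j, P.Gam e i j

noncomputable def mu0 (e : P.DirEdge) (i : Fin P.d) : ℝ := ⨆ j, P.Gam e i j

def ball : Set P.Msg :=
  {m | ∀ e : P.DirEdge, (∑ i, m (e, i)) = 1 ∧
    ∀ i, P.beta0 e i ≤ m (e, i) ∧ m (e, i) ≤ P.mu0 e i}

noncomputable def Cpsi : ℝ :=
  4 * (∑ e : P.DirEdge, ⨆ i, P.mu0 e i) / (∑ e : P.DirEdge, ⨅ i, P.beta0 e i)

noncomputable def sbpProb (m : P.Msg) (e : P.DirEdge) (j : Fin P.d) : ℝ :=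
  P.bmass e j * P.Mprod m e j / ∑ k, P.bmass e k * P.Mprod m e k

noncomputable def graphDiam : ℕ :=
  Finset.univ.sup fun pr : V × V => P.G.dist pr.1 pr.2

def IsSBP {Ω : Type*} {mΩ : MeasurableSpace Ω} (μ : Measure Ω)
    (ℱ : Filtration ℕ mΩ) (α : ℕ → ℝ) (m0 : P.Msg)
    (M : ℕ → Ω → P.Msg) (J : ℕ → Ω → P.DirEdge → Fin P.d) : Prop :=
  (∀ ω, M 0 ω = m0) ∧
  (∀ t, Measurable[ℱ t] (M t)) ∧
  (∀ t, Measurable[ℱ (t+1)] (J (t+1))) ∧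
  (∀ t ω (e : P.DirEdge) (i : Fin P.d),
      M (t+1) ω (e, i) = (1 - α t) * M t ω (e, i) + α t * P.Gam e i (J (t+1) ω e)) ∧
  (∀ t (jj : P.DirEdge → Fin P.d),
      (μ[(fun ω => if ∀ e, J (t+1) ω e = jj e then (1:ℝ) else 0) | ℱ t])
        =ᵐ[μ] fun ω => ∏ e : P.DirEdge, P.sbpProb (M t ω) e (jj e))


/-- The matrix operator norm induced by the Euclidean norm (maximum singular value). -/
noncomputable def mat2norm {n : Type*} [Fintype n] [DecidableEq n]
    (A : Matrix n n ℝ) : ℝ :=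
  ‖LinearMap.toContinuousLinearMap (Matrix.toEuclideanLin A)‖

/-- φ_{uv,wu} where `e = (u→v)` and `f = (w→u)`. -/
noncomputable def phi (e f : P.DirEdge) : ℝ :=
  ⨆ j : Fin P.d, sSup {r : ℝ | ∃ m ∈ P.ball, r = P.sbpProb m e j * (1 / m (f, j))}

/-- χ_{uv,wu} where `e = (u→v)` and `f = (w→u)`. -/
noncomputable def chi (e f : P.DirEdge) : ℝ :=
  ⨆ i : Fin P.d, sSup {r : ℝ | ∃ m ∈ P.ball,
    r = P.bmass e i * P.Mprod m e i / (∑ k, P.bmass e k * P.Mprod m e k) ^ 2 *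
        ∑ j, P.bmass e j * P.Mprod m e j / m (f, j)}

/-- Φ(u,v) = ∑_{w∈N(u)∖{v}} √(φ_{uv,wu}(φ_{uv,wu}+χ_{uv,wu})), where `e = (u→v)`. -/
noncomputable def PhiFun (e : P.DirEdge) : ℝ :=
  ∑ w ∈ ((P.G.neighborFinset e.1.1).erase e.1.2).attach,
    Real.sqrt (P.phi e (P.revEdge e w) * (P.phi e (P.revEdge e w) + P.chi e (P.revEdge e w)))

/-- The directed edge `(u → v)` for `v ∈ N(u) \ {w}`, where `f = (w → u)`. -/
def fwdEdge (f : P.DirEdge) (v : {x // x ∈ (P.G.neighborFinset f.1.2).erase f.1.1}) :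
    P.DirEdge :=
  ⟨(f.1.2, v.1), by
    have h := Finset.mem_of_mem_erase v.2
    rwa [SimpleGraph.mem_neighborFinset] at h⟩

/-- Φ′(w,u) = ∑_{v∈N(u)∖{w}} √(φ_{uv,wu}(φ_{uv,wu}+χ_{uv,wu})), where `f = (w → u)`. -/
noncomputable def PhiFun' (f : P.DirEdge) : ℝ :=
  ∑ v ∈ ((P.G.neighborFinset f.1.2).erase f.1.1).attach,
    Real.sqrt (P.phi (P.fwdEdge f v) f * (P.phi (P.fwdEdge f v) f + P.chi (P.fwdEdge f v) f))

end GM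

/-- The map `q : ℝ^D → ℝ^D` whose `(u→v)` component is the SBP sampling distribution. -/
noncomputable def GM.qmap {V : Type*} [Fintype V] [DecidableEq V] (P : GM V)
    (m : P.Msg) : P.Msg :=
  fun p => P.sbpProb m p.1 p.2

/-- Schur test for one Jacobian block. -/
theorem qlip_block {n : ℕ} (q m y δ : Fin n → ℝ) (φ χ : ℝ)
    (hq : ∀ i, 0 ≤ q i) (hq1 : ∑ i, q i = 1) (hm : ∀ i, 0 < m i)
    (hφ : ∀ j, q j / m j ≤ φ) (hχ : ∀ i, q i * ∑ j, q j / m j ≤ χ) :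
    (∑ i, y i * (q i * (δ i / m i - ∑ k, q k * (δ k / m k)))) ^ 2 ≤
      ((φ + χ) * ∑ i, y i ^ 2) * (2 * φ * ∑ i, δ i ^ 2) := by
  have hz : ∀ j, 0 ≤ q j / m j := fun j => div_nonneg (hq j) (hm j).le
  set a : Fin n × Fin n → ℝ := fun p =>
    (if p.1 = p.2 then q p.1 / m p.1 else 0) + q p.1 * (q p.2 / m p.2) with ha
  set J : Fin n × Fin n → ℝ := fun p =>
    (if p.1 = p.2 then q p.1 / m p.1 else 0) - q p.1 * (q p.2 / m p.2) with hJ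
  have ha0 : ∀ p, 0 ≤ a p := by
    intro p
    have h1 := hz p.1
    have h2 := mul_nonneg (hq p.1) (hz p.2)
    simp only [ha]
    split_ifs <;> linarith
  have hJa : ∀ p, J p ^ 2 ≤ a p ^ 2 := by
    intro p
    have h1 := hz p.1
    have h2 := mul_nonneg (hq p.1) (hz p.2)
    apply sq_le_sq'
    · simp only [ha, hJ]; split_ifs <;> linarith
    · simp only [ha, hJ]; split_ifs <;> linarith
  have e1 : ∑ i, y i * (q i * (δ i / m i - ∑ k, q k * (δ k / m k))) =
      ∑ p : Fin n × Fin n, J p * y p.1 * δ p.2 := by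
    rw [Fintype.sum_prod_type]
    refine Finset.sum_congr rfl fun i _ => ?_
    simp only [hJ, sub_mul, ite_mul, zero_mul, Finset.sum_sub_distrib, Finset.sum_ite_eq,
      Finset.mem_univ, if_true]
    rw [mul_sub, mul_sub, Finset.mul_sum, Finset.mul_sum]
    congr 1
    · ring
    · exact Finset.sum_congr rfl fun k _ => by ring
  have e2 : ∑ p : Fin n × Fin n, a p * y p.1 ^ 2 ≤ (φ + χ) * ∑ i, y i ^ 2 := by
    rw [Fintype.sum_prod_type, Finset.mul_sum]
    refine Finset.sum_le_sum fun i _ => ?_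
    dsimp only
    rw [← Finset.sum_mul]
    refine mul_le_mul_of_nonneg_right ?_ (sq_nonneg _)
    simp only [ha, Finset.sum_add_distrib, Finset.sum_ite_eq, Finset.mem_univ, if_true,
      ← Finset.mul_sum]
    exact add_le_add (hφ i) (hχ i)
  have e3 : ∑ p : Fin n × Fin n, a p * δ p.2 ^ 2 ≤ 2 * φ * ∑ i, δ i ^ 2 := by
    rw [Fintype.sum_prod_type, Finset.sum_comm, Finset.mul_sum]
    refine Finset.sum_le_sum fun i _ => ?_
    dsimp only
    rw [← Finset.sum_mul]
    refine mul_le_mul_of_nonneg_right ?_ (sq_nonneg _)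
    simp only [ha, Finset.sum_add_distrib, Finset.sum_ite_eq', Finset.mem_univ, if_true,
      ← Finset.sum_mul, hq1]
    linarith [hφ i]
  have hf0 : ∀ p : Fin n × Fin n, 0 ≤ a p * y p.1 ^ 2 := fun p => mul_nonneg (ha0 p) (sq_nonneg _)
  have hg0 : ∀ p : Fin n × Fin n, 0 ≤ a p * δ p.2 ^ 2 := fun p => mul_nonneg (ha0 p) (sq_nonneg _)
  rw [e1]
  refine (Finset.sum_sq_le_sum_mul_sum_of_sq_le_mul Finset.univ
    (f := fun p => a p * y p.1 ^ 2) (g := fun p => a p * δ p.2 ^ 2)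
    (fun p _ => hf0 p) (fun p _ => hg0 p) ?_).trans ?_
  · intro p _
    have := mul_le_mul_of_nonneg_right (hJa p) (sq_nonneg (y p.1 * δ p.2))
    nlinarith [this]
  · exact mul_le_mul e2 e3 (Finset.sum_nonneg fun p _ => hg0 p)
      ((Finset.sum_nonneg fun p _ => hf0 p).trans e2)

namespace GM

theorem sum_rev {V : Type*} [Fintype V] [DecidableEq V] (P : GM V) (e : P.DirEdge)
    (g : P.DirEdge → ℝ) :
    ∑ w ∈ ((P.G.neighborFinset e.1.1).erase e.1.2).attach, g (P.revEdge e w) =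
      ∑ f : P.DirEdge, if f.1.2 = e.1.1 ∧ f.1.1 ≠ e.1.2 then g f else 0 := by
  rw [← Finset.sum_filter]
  refine Finset.sum_bij (fun w _ => P.revEdge e w) ?_ ?_ ?_ ?_
  · intro w _
    simp only [Finset.mem_filter, Finset.mem_univ, true_and, revEdge]
    exact Finset.ne_of_mem_erase w.2
  · intro a _ b _ h
    have := congrArg (fun x : P.DirEdge => x.1.1) h
    exact Subtype.ext this
  · rintro ⟨⟨w, u⟩, hf⟩ h
    simp only [Finset.mem_filter, Finset.mem_univ, true_and] at h
    obtain ⟨h1, h2⟩ := h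
    refine ⟨⟨w, ?_⟩, Finset.mem_attach _ _, ?_⟩
    · rw [Finset.mem_erase, SimpleGraph.mem_neighborFinset]
      exact ⟨h2, h1 ▸ hf.symm⟩
    · exact Subtype.ext (Prod.ext rfl h1.symm)
  · intros; rfl

theorem sum_fwd {V : Type*} [Fintype V] [DecidableEq V] (P : GM V) (f : P.DirEdge)
    (g : P.DirEdge → ℝ) :
    ∑ v ∈ ((P.G.neighborFinset f.1.2).erase f.1.1).attach, g (P.fwdEdge f v) =
      ∑ e : P.DirEdge, if f.1.2 = e.1.1 ∧ f.1.1 ≠ e.1.2 then g e else 0 := by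
  rw [← Finset.sum_filter]
  refine Finset.sum_bij (fun w _ => P.fwdEdge f w) ?_ ?_ ?_ ?_
  · intro w _
    simp only [Finset.mem_filter, Finset.mem_univ, true_and, fwdEdge]
    exact (Finset.ne_of_mem_erase w.2).symm
  · intro a _ b _ h
    have := congrArg (fun x : P.DirEdge => x.1.2) h
    exact Subtype.ext this
  · rintro ⟨⟨u, v⟩, hf⟩ h
    simp only [Finset.mem_filter, Finset.mem_univ, true_and] at h
    obtain ⟨h1, h2⟩ := h
    refine ⟨⟨v, ?_⟩, Finset.mem_attach _ _, ?_⟩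
    · rw [Finset.mem_erase, SimpleGraph.mem_neighborFinset]
      exact ⟨h2.symm, h1 ▸ hf⟩
    · exact Subtype.ext (Prod.ext h1 rfl)
  · intros; rfl

section pos

variable {V : Type*} [Fintype V] [DecidableEq V] (P : GM V)

theorem bmass_pos (hd : 0 < P.d) (hψn : ∀ u j, 0 < P.ψn u j)
    (hψe : ∀ u v i j, 0 < P.ψe u v i j) (e : P.DirEdge) (j : Fin P.d) : 0 < P.bmass e j :=
  mul_pos (hψn _ _) (Finset.sum_pos (fun i _ => hψe _ _ _ _) ⟨⟨0, hd⟩, Finset.mem_univ _⟩)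

theorem beta0_pos (hd : 0 < P.d) (hψn : ∀ u j, 0 < P.ψn u j)
    (hψe : ∀ u v i j, 0 < P.ψe u v i j) (e : P.DirEdge) (i : Fin P.d) : 0 < P.beta0 e i := by
  haveI : Nonempty (Fin P.d) := ⟨⟨0, hd⟩⟩
  obtain ⟨j, hj⟩ := exists_eq_ciInf_of_finite (f := fun j => P.Gam e i j)
  rw [beta0, ← hj]
  exact div_pos (mul_pos (hψe _ _ _ _) (hψn _ _)) (P.bmass_pos hd hψn hψe e j)

theorem ball_pos (hd : 0 < P.d) (hψn : ∀ u j, 0 < P.ψn u j)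
    (hψe : ∀ u v i j, 0 < P.ψe u v i j) {m : P.Msg} (hm : m ∈ P.ball) (f : P.DirEdge)
    (j : Fin P.d) : 0 < m (f, j) :=
  (P.beta0_pos hd hψn hψe f j).trans_le ((hm f).2 j).1

theorem F_pos (hd : 0 < P.d) (hψn : ∀ u j, 0 < P.ψn u j)
    (hψe : ∀ u v i j, 0 < P.ψe u v i j) {m : P.Msg} (hm : m ∈ P.ball) (e : P.DirEdge)
    (j : Fin P.d) : 0 < P.bmass e j * P.Mprod m e j :=
  mul_pos (P.bmass_pos hd hψn hψe e j)
    (Finset.prod_pos fun w _ => P.ball_pos hd hψn hψe hm _ _)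

theorem Z_pos (hd : 0 < P.d) (hψn : ∀ u j, 0 < P.ψn u j)
    (hψe : ∀ u v i j, 0 < P.ψe u v i j) {m : P.Msg} (hm : m ∈ P.ball) (e : P.DirEdge) :
    0 < ∑ k, P.bmass e k * P.Mprod m e k :=
  Finset.sum_pos (fun k _ => P.F_pos hd hψn hψe hm e k) ⟨⟨0, hd⟩, Finset.mem_univ _⟩

theorem q_pos (hd : 0 < P.d) (hψn : ∀ u j, 0 < P.ψn u j)
    (hψe : ∀ u v i j, 0 < P.ψe u v i j) {m : P.Msg} (hm : m ∈ P.ball) (e : P.DirEdge)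
    (j : Fin P.d) : 0 < P.sbpProb m e j :=
  div_pos (P.F_pos hd hψn hψe hm e j) (P.Z_pos hd hψn hψe hm e)

theorem q_sum (hd : 0 < P.d) (hψn : ∀ u j, 0 < P.ψn u j)
    (hψe : ∀ u v i j, 0 < P.ψe u v i j) {m : P.Msg} (hm : m ∈ P.ball) (e : P.DirEdge) :
    ∑ j, P.sbpProb m e j = 1 := by
  simp only [sbpProb]
  rw [← Finset.sum_div]
  exact div_self (P.Z_pos hd hψn hψe hm e).ne'

theorem q_le_one (hd : 0 < P.d) (hψn : ∀ u j, 0 < P.ψn u j)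
    (hψe : ∀ u v i j, 0 < P.ψe u v i j) {m : P.Msg} (hm : m ∈ P.ball) (e : P.DirEdge)
    (j : Fin P.d) : P.sbpProb m e j ≤ 1 := by
  rw [← P.q_sum hd hψn hψe hm e]
  exact Finset.single_le_sum (f := fun j => P.sbpProb m e j)
    (fun k _ => (P.q_pos hd hψn hψe hm e k).le) (Finset.mem_univ j)

theorem ratio_le (hd : 0 < P.d) (hψn : ∀ u j, 0 < P.ψn u j)
    (hψe : ∀ u v i j, 0 < P.ψe u v i j) {m : P.Msg} (hm : m ∈ P.ball) (e f : P.DirEdge)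
    (j : Fin P.d) : P.sbpProb m e j / m (f, j) ≤ 1 / P.beta0 f j :=
  div_le_div₀ zero_le_one (P.q_le_one hd hψn hψe hm e j) (P.beta0_pos hd hψn hψe f j)
    ((hm f).2 j).1

theorem le_phi (hd : 0 < P.d) (hψn : ∀ u j, 0 < P.ψn u j)
    (hψe : ∀ u v i j, 0 < P.ψe u v i j) {m : P.Msg} (hm : m ∈ P.ball) (e f : P.DirEdge)
    (j : Fin P.d) : P.sbpProb m e j / m (f, j) ≤ P.phi e f := by
  refine le_ciSup_of_le (Set.finite_range _).bddAbove j ?_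
  refine le_csSup ⟨1 / P.beta0 f j, ?_⟩ ⟨m, hm, by ring⟩
  rintro r ⟨m', hm', rfl⟩
  have := P.ratio_le hd hψn hψe hm' e f j
  rwa [mul_one_div]

theorem chi_eq (m : P.Msg) (e f : P.DirEdge) (i : Fin P.d) :
    P.bmass e i * P.Mprod m e i / (∑ k, P.bmass e k * P.Mprod m e k) ^ 2 *
        ∑ j, P.bmass e j * P.Mprod m e j / m (f, j) =
      P.sbpProb m e i * ∑ j, P.sbpProb m e j / m (f, j) := by
  simp only [sbpProb]
  rw [Finset.mul_sum, Finset.mul_sum]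
  refine Finset.sum_congr rfl fun j _ => ?_
  ring

theorem le_chi (hd : 0 < P.d) (hψn : ∀ u j, 0 < P.ψn u j)
    (hψe : ∀ u v i j, 0 < P.ψe u v i j) {m : P.Msg} (hm : m ∈ P.ball) (e f : P.DirEdge)
    (i : Fin P.d) :
    P.sbpProb m e i * ∑ j, P.sbpProb m e j / m (f, j) ≤ P.chi e f := by
  refine le_ciSup_of_le (Set.finite_range _).bddAbove i ?_
  refine le_csSup ⟨∑ j, 1 / P.beta0 f j, ?_⟩ ⟨m, hm, (P.chi_eq m e f i).symm⟩
  rintro r ⟨m', hm', rfl⟩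
  rw [chi_eq]
  have h0 : 0 ≤ ∑ j, P.sbpProb m' e j / m' (f, j) := Finset.sum_nonneg fun j _ =>
    div_nonneg (P.q_pos hd hψn hψe hm' e j).le (P.ball_pos hd hψn hψe hm' f j).le
  exact (mul_le_of_le_one_left h0 (P.q_le_one hd hψn hψe hm' e i)).trans
    (Finset.sum_le_sum fun j _ => P.ratio_le hd hψn hψe hm' e f j)

theorem chi_nonneg (hd : 0 < P.d) (hψn : ∀ u j, 0 < P.ψn u j)
    (hψe : ∀ u v i j, 0 < P.ψe u v i j) {m : P.Msg} (hm : m ∈ P.ball) (e f : P.DirEdge) :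
    0 ≤ P.chi e f :=
  (mul_nonneg (P.q_pos hd hψn hψe hm e ⟨0, hd⟩).le (Finset.sum_nonneg fun j _ =>
    div_nonneg (P.q_pos hd hψn hψe hm e j).le (P.ball_pos hd hψn hψe hm f j).le)).trans
    (P.le_chi hd hψn hψe hm e f ⟨0, hd⟩)

theorem one_le_phi (hd : 0 < P.d) (hψn : ∀ u j, 0 < P.ψn u j)
    (hψe : ∀ u v i j, 0 < P.ψe u v i j) {m : P.Msg} (hm : m ∈ P.ball) (e f : P.DirEdge) :
    1 ≤ P.phi e f := by
  obtain ⟨j, _, hj⟩ : ∃ j ∈ (Finset.univ : Finset (Fin P.d)), m (f, j) ≤ P.sbpProb m e j := by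
    apply Finset.exists_le_of_sum_le ⟨⟨0, hd⟩, Finset.mem_univ _⟩
    rw [(hm f).1, P.q_sum hd hψn hψe hm e]
  refine le_trans ?_ (P.le_phi hd hψn hψe hm e f j)
  rwa [one_le_div (P.ball_pos hd hψn hψe hm f j)]

theorem ball_seg {m m' : P.Msg} (hm : m ∈ P.ball) (hm' : m' ∈ P.ball) {t : ℝ}
    (h0 : 0 ≤ t) (h1 : t ≤ 1) : (fun p => m p + t * (m' p - m p)) ∈ P.ball := by
  intro e
  refine ⟨?_, fun i => ⟨?_, ?_⟩⟩
  · simp only [Finset.sum_add_distrib, ← Finset.mul_sum, Finset.sum_sub_distrib, (hm e).1,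
      (hm' e).1]
    ring
  · have a := ((hm e).2 i).1
    have b := ((hm' e).2 i).1
    simp only
    nlinarith [mul_nonneg h0 (sub_nonneg.2 b), mul_nonneg (sub_nonneg.2 h1) (sub_nonneg.2 a)]
  · have a := ((hm e).2 i).2
    have b := ((hm' e).2 i).2
    simp only
    nlinarith [mul_nonneg h0 (sub_nonneg.2 b), mul_nonneg (sub_nonneg.2 h1) (sub_nonneg.2 a)]

/-- Derivative of the sampling distribution along a segment. -/
theorem q_deriv (m δ : P.Msg) (t : ℝ) (e : P.DirEdge) (i : Fin P.d)
    (hp : ∀ f j, 0 < m (f, j) + t * δ (f, j))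
    (hZ : 0 < ∑ k, P.bmass e k * P.Mprod (fun p => m p + t * δ p) e k) :
    HasDerivAt (fun s : ℝ => P.sbpProb (fun p => m p + s * δ p) e i)
      (∑ w ∈ ((P.G.neighborFinset e.1.1).erase e.1.2).attach,
        P.sbpProb (fun p => m p + t * δ p) e i *
          (δ (P.revEdge e w, i) / (m (P.revEdge e w, i) + t * δ (P.revEdge e w, i)) -
            ∑ k, P.sbpProb (fun p => m p + t * δ p) e k *
              (δ (P.revEdge e w, k) / (m (P.revEdge e w, k) + t * δ (P.revEdge e w, k))))) t := by
  set L : Fin P.d → ℝ := fun k => ∑ w ∈ ((P.G.neighborFinset e.1.1).erase e.1.2).attach,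
    δ (P.revEdge e w, k) / (m (P.revEdge e w, k) + t * δ (P.revEdge e w, k)) with hL
  have hF : ∀ k, HasDerivAt (fun s : ℝ => P.bmass e k * P.Mprod (fun p => m p + s * δ p) e k)
      (P.bmass e k * P.Mprod (fun p => m p + t * δ p) e k * L k) t := by
    intro k
    have h1 : ∀ w ∈ ((P.G.neighborFinset e.1.1).erase e.1.2).attach,
        HasDerivAt (fun s : ℝ => m (P.revEdge e w, k) + s * δ (P.revEdge e w, k))
          (δ (P.revEdge e w, k)) t := by
      intro w _
      have := ((hasDerivAt_id t).mul_const (δ (P.revEdge e w, k))).const_add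
        (m (P.revEdge e w, k))
      simpa using this
    have h2 := (HasDerivAt.fun_finsetProd h1).const_mul (P.bmass e k)
    refine h2.congr_deriv ?_
    rw [mul_assoc]
    congr 1
    rw [hL, Finset.mul_sum]
    refine Finset.sum_congr rfl fun w hw => ?_
    rw [Mprod, ← Finset.mul_prod_erase _ _ hw, smul_eq_mul]
    have := (hp (P.revEdge e w) k).ne'
    field_simp
  have hS := HasDerivAt.fun_sum (u := Finset.univ) fun k _ => hF k
  have hD := (hF i).fun_div hS hZ.ne'
  refine hD.congr_deriv ?_
  have e1 : ∑ w ∈ ((P.G.neighborFinset e.1.1).erase e.1.2).attach,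
        P.sbpProb (fun p => m p + t * δ p) e i *
          (δ (P.revEdge e w, i) / (m (P.revEdge e w, i) + t * δ (P.revEdge e w, i)) -
            ∑ k, P.sbpProb (fun p => m p + t * δ p) e k *
              (δ (P.revEdge e w, k) / (m (P.revEdge e w, k) + t * δ (P.revEdge e w, k)))) =
      P.sbpProb (fun p => m p + t * δ p) e i *
        (L i - ∑ k, P.sbpProb (fun p => m p + t * δ p) e k * L k) := by
    rw [← Finset.mul_sum, Finset.sum_sub_distrib, Finset.sum_comm]
    simp only [hL, Finset.mul_sum]
  rw [e1]
  simp only [sbpProb]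
  generalize hZ' : ∑ k, P.bmass e k * P.Mprod (fun p => m p + t * δ p) e k = Z at *
  have e2 : ∑ k, P.bmass e k * P.Mprod (fun p => m p + t * δ p) e k / Z * L k =
      (∑ k, P.bmass e k * P.Mprod (fun p => m p + t * δ p) e k * L k) / Z := by
    rw [Finset.sum_div]
    exact Finset.sum_congr rfl fun k _ => by ring
  rw [e2]
  have := hZ.ne'
  field_simp

theorem PhiFun_eq (e : P.DirEdge) : P.PhiFun e = ∑ f : P.DirEdge,
    if f.1.2 = e.1.1 ∧ f.1.1 ≠ e.1.2 then Real.sqrt (P.phi e f * (P.phi e f + P.chi e f))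
      else 0 :=
  P.sum_rev e fun f => Real.sqrt (P.phi e f * (P.phi e f + P.chi e f))

theorem PhiFun'_eq (f : P.DirEdge) : P.PhiFun' f = ∑ e : P.DirEdge,
    if f.1.2 = e.1.1 ∧ f.1.1 ≠ e.1.2 then Real.sqrt (P.phi e f * (P.phi e f + P.chi e f))
      else 0 :=
  P.sum_fwd f fun e => Real.sqrt (P.phi e f * (P.phi e f + P.chi e f))

/-- Bound for the bilinear form of the Jacobian at a point of the ball. -/
theorem bilin (hd : 0 < P.d) (hψn : ∀ u j, 0 < P.ψn u j)
    (hψe : ∀ u v i j, 0 < P.ψe u v i j) {m : P.Msg} (hm : m ∈ P.ball) (y δ : P.Msg) :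
    (∑ p : P.DirEdge × Fin P.d, y p *
      ∑ w ∈ ((P.G.neighborFinset p.1.1.1).erase p.1.1.2).attach,
        P.sbpProb m p.1 p.2 *
          (δ (P.revEdge p.1 w, p.2) / m (P.revEdge p.1 w, p.2) -
            ∑ k, P.sbpProb m p.1 k *
              (δ (P.revEdge p.1 w, k) / m (P.revEdge p.1 w, k)))) ^ 2 ≤
      (2 * (⨆ e : P.DirEdge, P.PhiFun e) * (⨆ f : P.DirEdge, P.PhiFun' f)) *
        (∑ p, y p ^ 2) * ∑ p, δ p ^ 2 := by
  set K : P.DirEdge → P.DirEdge → ℝ := fun e f =>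
    if f.1.2 = e.1.1 ∧ f.1.1 ≠ e.1.2 then Real.sqrt (P.phi e f * (P.phi e f + P.chi e f))
      else 0 with hK
  have hK0 : ∀ e f, 0 ≤ K e f := by
    intro e f; simp only [hK]; split_ifs
    · exact Real.sqrt_nonneg _
    · exact le_rfl
  set b : P.DirEdge → P.DirEdge → ℝ := fun e f =>
    ∑ i, y (e, i) * (P.sbpProb m e i * (δ (f, i) / m (f, i) -
      ∑ k, P.sbpProb m e k * (δ (f, k) / m (f, k)))) with hb
  set r : P.DirEdge × P.DirEdge → ℝ := fun p =>
    if p.2.1.2 = p.1.1.1 ∧ p.2.1.1 ≠ p.1.1.2 then b p.1 p.2 else 0 with hr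
  have e1 : (∑ p : P.DirEdge × Fin P.d, y p *
      ∑ w ∈ ((P.G.neighborFinset p.1.1.1).erase p.1.1.2).attach,
        P.sbpProb m p.1 p.2 *
          (δ (P.revEdge p.1 w, p.2) / m (P.revEdge p.1 w, p.2) -
            ∑ k, P.sbpProb m p.1 k *
              (δ (P.revEdge p.1 w, k) / m (P.revEdge p.1 w, k)))) = ∑ p, r p := by
    rw [Fintype.sum_prod_type, Fintype.sum_prod_type]
    refine Finset.sum_congr rfl fun e _ => ?_
    rw [← P.sum_rev e (fun f => b e f)]
    simp only [hb]
    refine Eq.trans ?_ Finset.sum_comm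
    exact Finset.sum_congr rfl fun i _ => Finset.mul_sum _ _ _
  have hr2 : ∀ p, r p ^ 2 ≤ (2 * (K p.1 p.2 * ∑ i, y (p.1, i) ^ 2)) *
      (K p.1 p.2 * ∑ i, δ (p.2, i) ^ 2) := by
    rintro ⟨e, f⟩
    simp only [hr, hK]
    split_ifs
    · have h := qlip_block (fun i => P.sbpProb m e i) (fun i => m (f, i)) (fun i => y (e, i))
        (fun i => δ (f, i)) (P.phi e f) (P.chi e f)
        (fun i => (P.q_pos hd hψn hψe hm e i).le) (P.q_sum hd hψn hψe hm e)
        (fun i => P.ball_pos hd hψn hψe hm f i) (P.le_phi hd hψn hψe hm e f)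
        (P.le_chi hd hψn hψe hm e f)
      refine h.trans (le_of_eq ?_)
      have h1 := P.one_le_phi hd hψn hψe hm e f
      have h2 := P.chi_nonneg hd hψn hψe hm e f
      have hs := Real.mul_self_sqrt (show 0 ≤ P.phi e f * (P.phi e f + P.chi e f) by positivity)
      linear_combination (-2 * (∑ i, y (e, i) ^ 2) * ∑ i, δ (f, i) ^ 2) * hs
    · simp
  have hy0 : ∀ e, 0 ≤ ∑ i, y (e, i) ^ 2 := fun e => Finset.sum_nonneg fun i _ => sq_nonneg _
  have hδ0 : ∀ e, 0 ≤ ∑ i, δ (e, i) ^ 2 := fun e => Finset.sum_nonneg fun i _ => sq_nonneg _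
  have hf0 : ∀ p : P.DirEdge × P.DirEdge, 0 ≤ 2 * (K p.1 p.2 * ∑ i, y (p.1, i) ^ 2) :=
    fun p => mul_nonneg zero_le_two (mul_nonneg (hK0 _ _) (hy0 _))
  have hg0 : ∀ p : P.DirEdge × P.DirEdge, 0 ≤ K p.1 p.2 * ∑ i, δ (p.2, i) ^ 2 :=
    fun p => mul_nonneg (hK0 _ _) (hδ0 _)
  have e2 : ∑ p : P.DirEdge × P.DirEdge, 2 * (K p.1 p.2 * ∑ i, y (p.1, i) ^ 2) ≤
      2 * (⨆ e : P.DirEdge, P.PhiFun e) * ∑ p, y p ^ 2 := by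
    rw [← Finset.mul_sum, mul_assoc]
    refine mul_le_mul_of_nonneg_left ?_ zero_le_two
    rw [Fintype.sum_prod_type, Fintype.sum_prod_type, Finset.mul_sum]
    refine Finset.sum_le_sum fun e _ => ?_
    dsimp only
    rw [← Finset.sum_mul]
    refine mul_le_mul_of_nonneg_right ?_ (hy0 e)
    rw [hK, ← P.PhiFun_eq e]
    exact le_ciSup (Set.finite_range _).bddAbove e
  have e3 : ∑ p : P.DirEdge × P.DirEdge, K p.1 p.2 * ∑ i, δ (p.2, i) ^ 2 ≤
      (⨆ e : P.DirEdge, P.PhiFun' e) * ∑ p, δ p ^ 2 := by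
    rw [Fintype.sum_prod_type, Fintype.sum_prod_type, Finset.mul_sum, Finset.sum_comm]
    refine Finset.sum_le_sum fun e _ => ?_
    dsimp only
    rw [← Finset.sum_mul]
    refine mul_le_mul_of_nonneg_right ?_ (hδ0 e)
    rw [hK, ← P.PhiFun'_eq e]
    exact le_ciSup (Set.finite_range _).bddAbove e
  rw [e1]
  refine (Finset.sum_sq_le_sum_mul_sum_of_sq_le_mul Finset.univ (fun p _ => hf0 p)
    (fun p _ => hg0 p) (fun p _ => hr2 p)).trans ?_
  refine (mul_le_mul e2 e3 (Finset.sum_nonneg fun p _ => hg0 p)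
      ((Finset.sum_nonneg fun p _ => hf0 p).trans e2)).trans (le_of_eq ?_)
  ring

/-- The constant is either at least two, or there are no interacting edges. -/
theorem const_dich (hd : 0 < P.d) (hψn : ∀ u j, 0 < P.ψn u j)
    (hψe : ∀ u v i j, 0 < P.ψe u v i j) {m : P.Msg} (hm : m ∈ P.ball) :
    2 * (⨆ e : P.DirEdge, P.PhiFun e) * (⨆ f : P.DirEdge, P.PhiFun' f) = 0 ∨
    2 ≤ 2 * (⨆ e : P.DirEdge, P.PhiFun e) * (⨆ f : P.DirEdge, P.PhiFun' f) := by
  by_cases h : ∃ e f : P.DirEdge, f.1.2 = e.1.1 ∧ f.1.1 ≠ e.1.2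
  · right
    obtain ⟨e, f, hef⟩ := h
    have h1 := P.one_le_phi hd hψn hψe hm e f
    have h2 := P.chi_nonneg hd hψn hψe hm e f
    have hs : 1 ≤ Real.sqrt (P.phi e f * (P.phi e f + P.chi e f)) := by
      rw [Real.one_le_sqrt]; nlinarith
    have hK0 : ∀ e f : P.DirEdge, 0 ≤ if f.1.2 = e.1.1 ∧ f.1.1 ≠ e.1.2 then
        Real.sqrt (P.phi e f * (P.phi e f + P.chi e f)) else 0 := by
      intro e f; split_ifs
      · exact Real.sqrt_nonneg _
      · exact le_rfl
    have a : 1 ≤ ⨆ e : P.DirEdge, P.PhiFun e := by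
      refine le_ciSup_of_le (Set.finite_range _).bddAbove e ?_
      rw [PhiFun_eq]
      refine le_trans ?_ (Finset.single_le_sum (fun f _ => hK0 e f) (Finset.mem_univ f))
      rwa [if_pos hef]
    have b : 1 ≤ ⨆ e : P.DirEdge, P.PhiFun' e := by
      refine le_ciSup_of_le (Set.finite_range _).bddAbove f ?_
      rw [PhiFun'_eq]
      refine le_trans ?_ (Finset.single_le_sum (fun e _ => hK0 e f) (Finset.mem_univ e))
      rwa [if_pos hef]
    nlinarith
  · left
    push Not at h
    have : ∀ e : P.DirEdge, P.PhiFun e = 0 := by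
      intro e
      rw [PhiFun_eq]
      refine Finset.sum_eq_zero fun f _ => if_neg ?_
      rintro ⟨h1, h2⟩
      exact h2 (h e f h1)
    simp [this]

end pos

end GM

/-- Lemma 3: For all `m ≠ m′` in `B`,
`‖q(m) − q(m′)‖₂ / ‖m − m′‖₂ ≤ 2 · max_{(u→v)} Φ(u,v) · max_{(w→u)} Φ′(w,u)`. -/
theorem qmap_lipschitz_ratio_bound
    {V : Type*} [Fintype V] [DecidableEq V] (P : GM V)
    (hd : 0 < P.d)
    (hψn : ∀ u j, 0 < P.ψn u j)
    (hψe : ∀ u v i j, 0 < P.ψe u v i j)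
    (hψsymm : ∀ u v i j, P.ψe u v i j = P.ψe v u j i) :
    ∀ m ∈ P.ball, ∀ m' ∈ P.ball, m ≠ m' →
      l2norm (P.qmap m - P.qmap m') / l2norm (m - m') ≤
        2 * (⨆ e : P.DirEdge, P.PhiFun e) * (⨆ f : P.DirEdge, P.PhiFun' f) := by
  intro m hm m' hm' hne
  set C := 2 * (⨆ e : P.DirEdge, P.PhiFun e) * (⨆ f : P.DirEdge, P.PhiFun' f) with hC
  set y : P.Msg := P.qmap m - P.qmap m' with hy
  set δ : P.Msg := fun p => m p - m' p with hδ
  set D : ℝ → P.Msg := fun t p =>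
    ∑ w ∈ ((P.G.neighborFinset p.1.1.1).erase p.1.1.2).attach,
        P.sbpProb (fun p => m' p + t * δ p) p.1 p.2 *
          (δ (P.revEdge p.1 w, p.2) / (m' (P.revEdge p.1 w, p.2) + t * δ (P.revEdge p.1 w, p.2)) -
            ∑ k, P.sbpProb (fun p => m' p + t * δ p) p.1 k *
              (δ (P.revEdge p.1 w, k) /
                (m' (P.revEdge p.1 w, k) + t * δ (P.revEdge p.1 w, k)))) with hD
  have hball : ∀ t : ℝ, 0 ≤ t → t ≤ 1 → (fun p => m' p + t * δ p) ∈ P.ball :=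
    fun t h0 h1 => P.ball_seg hm' hm h0 h1
  have hder : ∀ t : ℝ, 0 ≤ t → t ≤ 1 →
      HasDerivAt (fun s : ℝ => ∑ p, y p * P.qmap (fun p => m' p + s * δ p) p)
        (∑ p, y p * D t p) t := by
    intro t h0 h1
    refine HasDerivAt.fun_sum fun p _ => HasDerivAt.const_mul (y p) ?_
    exact P.q_deriv m' δ t p.1 p.2
      (fun f j => P.ball_pos hd hψn hψe (hball t h0 h1) f j)
      (P.Z_pos hd hψn hψe (hball t h0 h1) p.1)
  obtain ⟨t, ht, hmv⟩ := exists_hasDerivAt_eq_slope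
    (fun s : ℝ => ∑ p, y p * P.qmap (fun p => m' p + s * δ p) p)
    (fun t => ∑ p, y p * D t p) (zero_lt_one)
    (fun t ht => (hder t ht.1 ht.2).continuousAt.continuousWithinAt)
    (fun t ht => hder t ht.1.le ht.2.le)
  have h1 : (fun p => m' p + 1 * δ p) = m := by
    funext p; simp only [hδ]; ring
  have h0 : (fun p => m' p + 0 * δ p) = m' := by
    funext p; ring
  have hT : ∑ p, y p * D t p = ∑ p, y p ^ 2 := by
    rw [hmv]
    simp only [h1, h0]
    rw [← Finset.sum_sub_distrib, sub_zero, div_one]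
    refine Finset.sum_congr rfl fun p _ => ?_
    simp only [hy, Pi.sub_apply]
    ring
  have hB := P.bilin hd hψn hψe (hball t ht.1.le ht.2.le) y δ
  change (∑ p, y p * D t p) ^ 2 ≤ C * (∑ p, y p ^ 2) * ∑ p, δ p ^ 2 at hB
  rw [hT] at hB
  have hC0 : C = 0 ∨ 2 ≤ C := P.const_dich hd hψn hψe hm
  have hCn : 0 ≤ C := by rcases hC0 with h | h <;> linarith
  have hY0 : 0 ≤ ∑ p, y p ^ 2 := Finset.sum_nonneg fun p _ => sq_nonneg _
  have hX0 : 0 ≤ ∑ p, δ p ^ 2 := Finset.sum_nonneg fun p _ => sq_nonneg _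
  have key : ∑ p, y p ^ 2 ≤ C ^ 2 * ∑ p, δ p ^ 2 := by
    have k1 : ∑ p, y p ^ 2 ≤ C * ∑ p, δ p ^ 2 := by
      rcases hY0.eq_or_lt with h | h
      · rw [← h]; exact mul_nonneg hCn hX0
      · refine le_of_mul_le_mul_right ?_ h
        linarith [hB]
    refine k1.trans (mul_le_mul_of_nonneg_right ?_ hX0)
    rcases hC0 with h | h
    · rw [h]; norm_num
    · nlinarith
  refine div_le_of_le_mul₀ (Real.sqrt_nonneg _) hCn ?_
  change Real.sqrt (∑ p, y p ^ 2) ≤ C * Real.sqrt (∑ p, δ p ^ 2)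
  rw [← Real.sqrt_sq hCn, ← Real.sqrt_mul (sq_nonneg C)]
  exact Real.sqrt_le_sqrt key
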